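/- Let X be a set and f : X → Set X a multivalued function with x ∉ f(x) for all x, and suppose |f(x)| ≤ N and |f⁻¹(x)| ≤ N for all x ∈ X. Then there is a partition of X into 2N+1 sets A₁, …, A_{2N+1} such that y ∉ f(x) whenever x, y ∈ Aᵢ (including the case x = y). -/

import Mathlib

/-- Multivalued Katětov lemma for functions without fixed points:
the conclusion holds for all (not necessarily distinct) pairs in a part. -/
theorem multivalued_katetov_fixed_point_free {X : Type*} (f : X → Set X) (N : ℕ)
    (hfp : ∀ x, x ∉ f x)
    (hfin : ∀ x, (f x).Finite) (hcard : ∀ x, (f x).ncard ≤ N)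
    (hpre_fin : ∀ x, {y | x ∈ f y}.Finite)
    (hpre_card : ∀ x, {y | x ∈ f y}.ncard ≤ N) :
    ∃ A : Fin (2 * N + 1) → Set X, (∀ x, ∃! i, x ∈ A i) ∧
      ∀ i, ∀ x ∈ A i, ∀ y ∈ A i, y ∉ f x := by
  classical
  -- greedy colouring along a well-order of `X`
  have key : ∀ (x : X) (g : X → Fin (2 * N + 1)),
      ∃ k, ∀ y ∈ f x ∪ {y | x ∈ f y}, g y ≠ k := by
    intro x g
    by_contra! h
    have hsub : (Set.univ : Set (Fin (2 * N + 1))) ⊆ g '' (f x ∪ {y | x ∈ f y}) := by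
      intro k _
      obtain ⟨y, hy, e⟩ := h k
      exact ⟨y, hy, e⟩
    have hf := (hfin x).union (hpre_fin x)
    have h1 := Set.ncard_le_ncard hsub (hf.image g)
    have h2 := Set.ncard_image_le (f := g) hf
    have h3 := Set.ncard_union_le (f x) {y | x ∈ f y}
    have h4 := hcard x
    have h5 := hpre_card x
    rw [Set.ncard_univ, Nat.card_eq_fintype_card, Fintype.card_fin] at h1
    omega
  choose col hcol using key
  let F : ∀ x : X, (∀ y, WellOrderingRel y x → Fin (2 * N + 1)) → Fin (2 * N + 1) :=
    fun x r => col x (fun y => if h : WellOrderingRel y x then r y h else 0)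
  have wf : WellFounded (WellOrderingRel : X → X → Prop) := IsWellFounded.wf
  let c : X → Fin (2 * N + 1) := wf.fix F
  have hc : ∀ x y, WellOrderingRel y x → y ∈ f x ∪ {y | x ∈ f y} → c y ≠ c x := by
    intro x y hyx hy
    have e : c x = F x (fun y _ => c y) := wf.fix_eq F x
    have := hcol x (fun y => if h : WellOrderingRel y x then c y else 0) y hy
    rw [e]
    simpa [hyx, F] using this
  refine ⟨fun i => {x | c x = i}, fun x => ⟨c x, rfl, fun i hi => hi.symm⟩, ?_⟩
  rintro i x hx y hy hxy
  have hx' : c x = i := hx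
  have hy' : c y = i := hy
  rcases trichotomous_of WellOrderingRel x y with h | h | h
  · exact hc y x h (Or.inr hxy) (hx'.trans hy'.symm)
  · subst h
    exact hfp x hxy
  · exact hc x y h (Or.inl hxy) (hy'.trans hx'.symm)
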